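/- Let k be a nonnegative even integer, let f : ℍ → ℂ be holomorphic with iterated Shimura–Maass derivatives ∂^n f of base weight k, and let p ∈ ℍ with y = Im p. For z ∈ ℍ write w = w(p;z) and define s_n(z) = Σ_{t=0}^{n} (−1)^{n−t}·C(n,t)·(1−w)^t/(y^t·(Im z)^{n−t}). Then for every m ≥ 0 and every z ∈ ℍ, (∂^m f)(z) = Σ_{r=0}^{m} C(m,r) · (k+r)_{m−r} · s_{m−r}(z)/(4π)^{m−r} · (1−w)^{k+2r} · Σ_{n=0}^{∞} ((∂^{n+r} f)(p)/n!)·(−4πy)^n·w^n, where each inner series converges. -/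

import Mathlib

open Complex

/-- The map `w(p; ·) : z ↦ (z − p)/(z − conj p)` from the upper half-plane to the unit disc. -/
noncomputable def wmap (p z : ℂ) : ℂ := (z - p) / (z - (starRingEnd ℂ) p)

/-- The Wirtinger derivative `∂_z = (1/2)(∂/∂x − i ∂/∂y)` of `f : ℂ → ℂ` at `z`. -/
noncomputable def wirtingerDeriv (f : ℂ → ℂ) (z : ℂ) : ℂ :=
  (1 / 2) * (fderiv ℝ f z 1 - Complex.I * fderiv ℝ f z Complex.I)

/-- The iterated Shimura–Maass derivative `∂^n f` of base weight `k`. -/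
noncomputable def smIter (k : ℤ) (f : ℂ → ℂ) : ℕ → ℂ → ℂ
  | 0 => f
  | n + 1 => fun z => (1 / (2 * (Real.pi : ℂ) * Complex.I)) *
      (wirtingerDeriv (smIter k f n) z +
        ((k : ℂ) + 2 * n) * smIter k f n z / (z - (starRingEnd ℂ) z))

/-- The auxiliary function `s_n(z) = Σ_{t=0}^n (−1)^{n−t} C(n,t) (1−w)^t/(y^t (Im z)^{n−t})`
where `w = w(p;z)` and `y = Im p`. -/
noncomputable def sfun (p : ℂ) (n : ℕ) (z : ℂ) : ℂ :=
  ∑ t ∈ Finset.range (n + 1),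
    (-1) ^ (n - t) * (n.choose t : ℂ) * (1 - wmap p z) ^ t /
      ((p.im : ℂ) ^ t * (z.im : ℂ) ^ (n - t))

/-- `f` is real-differentiable at `z` with Wirtinger derivative `f'`. -/
def HasWirtingerDerivAt (f : ℂ → ℂ) (f' z : ℂ) : Prop :=
  ∃ L : ℂ →L[ℝ] ℂ, HasFDerivAt f L z ∧ (1 / 2) * (L 1 - Complex.I * L Complex.I) = f'

namespace HasWirtingerDerivAt

variable {f g : ℂ → ℂ} {f' g' z : ℂ}

lemma wirtingerDeriv_eq (h : HasWirtingerDerivAt f f' z) : wirtingerDeriv f z = f' := by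
  obtain ⟨L, hL, rfl⟩ := h
  simp only [wirtingerDeriv, hL.fderiv]

lemma congr_deriv (h : HasWirtingerDerivAt f f' z) (hf : f' = g') :
    HasWirtingerDerivAt f g' z :=
  hf ▸ h

lemma congr_of_eventuallyEq (h : HasWirtingerDerivAt f f' z) (hfg : g =ᶠ[nhds z] f) :
    HasWirtingerDerivAt g f' z := by
  obtain ⟨L, hL, hf⟩ := h
  exact ⟨L, hL.congr_of_eventuallyEq hfg, hf⟩

lemma mul (hf : HasWirtingerDerivAt f f' z) (hg : HasWirtingerDerivAt g g' z) :
    HasWirtingerDerivAt (fun x => f x * g x) (f' * g z + f z * g') z := by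
  obtain ⟨L, hL, rfl⟩ := hf
  obtain ⟨M, hM, rfl⟩ := hg
  refine ⟨_, hL.mul hM, ?_⟩
  simp only [add_apply, smul_apply, smul_eq_mul]
  ring

lemma sub (hf : HasWirtingerDerivAt f f' z) (hg : HasWirtingerDerivAt g g' z) :
    HasWirtingerDerivAt (fun x => f x - g x) (f' - g') z := by
  obtain ⟨L, hL, rfl⟩ := hf
  obtain ⟨M, hM, rfl⟩ := hg
  refine ⟨_, hL.sub hM, ?_⟩
  simp only [sub_apply]
  ring

lemma const_mul (c : ℂ) (hf : HasWirtingerDerivAt f f' z) :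
    HasWirtingerDerivAt (fun x => c * f x) (c * f') z := by
  obtain ⟨L, hL, rfl⟩ := hf
  refine ⟨_, hL.const_mul c, ?_⟩
  simp only [smul_apply, smul_eq_mul]
  ring

lemma sum {ι : Type*} (s : Finset ι) {f : ι → ℂ → ℂ} {f' : ι → ℂ}
    (h : ∀ i ∈ s, HasWirtingerDerivAt (f i) (f' i) z) :
    HasWirtingerDerivAt (fun x => ∑ i ∈ s, f i x) (∑ i ∈ s, f' i) z := by
  choose! L hL hf using h
  refine ⟨_, HasFDerivAt.fun_sum hL, ?_⟩
  rw [← Finset.sum_congr rfl hf]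
  simp only [sum_apply, Finset.mul_sum, ← Finset.sum_sub_distrib]

lemma comp (hg : HasDerivAt g g' (f z)) (hf : HasWirtingerDerivAt f f' z) :
    HasWirtingerDerivAt (fun x => g (f x)) (g' * f') z := by
  obtain ⟨L, hL, rfl⟩ := hf
  refine ⟨_, (hg.hasFDerivAt.restrictScalars ℝ).comp z hL, ?_⟩
  simp
  ring

lemma pow (hf : HasWirtingerDerivAt f f' z) (n : ℕ) :
    HasWirtingerDerivAt (fun x => f x ^ n) (n * f z ^ (n - 1) * f') z :=
  comp (g := fun x => x ^ n) (hasDerivAt_pow n (f z)) hf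

end HasWirtingerDerivAt

lemma HasDerivAt.hasWirtingerDerivAt {f : ℂ → ℂ} {f' z : ℂ} (h : HasDerivAt f f' z) :
    HasWirtingerDerivAt f f' z := by
  refine ⟨_, h.hasFDerivAt.restrictScalars ℝ, ?_⟩
  simp
  linear_combination (-f' / 2) * Complex.I_mul_I

lemma hasWirtingerDerivAt_im (z : ℂ) :
    HasWirtingerDerivAt (fun x => (x.im : ℂ)) (-Complex.I / 2) z := by
  refine ⟨_, (Complex.ofRealCLM.comp Complex.imCLM).hasFDerivAt, ?_⟩
  simp
  ring

lemma hasWirtingerDerivAt_inv_im {z : ℂ} (hz : 0 < z.im) :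
    HasWirtingerDerivAt (fun x => (x.im : ℂ)⁻¹) (Complex.I / 2 * ((z.im : ℂ)⁻¹) ^ 2) z := by
  have hz' : (z.im : ℂ) ≠ 0 := by exact_mod_cast hz.ne'
  convert HasWirtingerDerivAt.comp (hasDerivAt_inv hz') (hasWirtingerDerivAt_im z) using 1
  field_simp

section DiscCoordinate

variable {p z : ℂ}

lemma sub_conj_ne_zero (hp : 0 < p.im) (hz : 0 < z.im) : z - (starRingEnd ℂ) p ≠ 0 := by
  intro h
  have := congrArg Complex.im h
  simp at this
  linarith

lemma one_sub_wmap (hp : 0 < p.im) (hz : 0 < z.im) :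
    1 - wmap p z = 2 * Complex.I * p.im / (z - (starRingEnd ℂ) p) := by
  have h := sub_conj_ne_zero hp hz
  have h' := Complex.sub_conj p
  rw [wmap, eq_div_iff h, sub_mul, div_mul_cancel₀ _ h]
  push_cast at h'
  linear_combination h'

lemma one_sub_wmap_ne_zero (hp : 0 < p.im) (hz : 0 < z.im) : 1 - wmap p z ≠ 0 := by
  have hp' : (p.im : ℂ) ≠ 0 := by exact_mod_cast hp.ne'
  rw [one_sub_wmap hp hz]
  exact div_ne_zero (by simp [hp']) (sub_conj_ne_zero hp hz)

lemma norm_wmap_lt_one (hp : 0 < p.im) (hz : 0 < z.im) : ‖wmap p z‖ < 1 := by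
  rw [wmap, norm_div, div_lt_one (norm_pos_iff.mpr (sub_conj_ne_zero hp hz)),
    ← sq_lt_sq₀ (norm_nonneg _) (norm_nonneg _), Complex.sq_norm, Complex.sq_norm,
    Complex.normSq_apply, Complex.normSq_apply]
  simp
  nlinarith [mul_pos hp hz]

lemma hasDerivAt_wmap (hp : 0 < p.im) (hz : 0 < z.im) :
    HasDerivAt (wmap p) ((1 - wmap p z) ^ 2 / (2 * Complex.I * p.im)) z := by
  have h := sub_conj_ne_zero hp hz
  have hp' : (p.im : ℂ) ≠ 0 := by exact_mod_cast hp.ne'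
  have h' := Complex.sub_conj p
  push_cast at h'
  refine HasDerivAt.congr_deriv (((hasDerivAt_id z).sub_const p).fun_div
    ((hasDerivAt_id z).sub_const _) h) ?_
  rw [one_sub_wmap hp hz]
  simp only [id]
  field_simp
  linear_combination h'

/-- The inverse of `wmap p`. -/
noncomputable def wmapInv (p w : ℂ) : ℂ := (p - (starRingEnd ℂ) p * w) / (1 - w)

lemma one_sub_ne_zero_of_norm_lt_one {w : ℂ} (hw : ‖w‖ < 1) : 1 - w ≠ 0 := by
  intro h
  rw [← sub_eq_zero.mp h] at hw
  simp at hw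

lemma wmapInv_im_pos (hp : 0 < p.im) {w : ℂ} (hw : ‖w‖ < 1) : 0 < (wmapInv p w).im := by
  have h1 : 0 < Complex.normSq (1 - w) :=
    Complex.normSq_pos.mpr (one_sub_ne_zero_of_norm_lt_one hw)
  have h2 : w.re * w.re + w.im * w.im < 1 := by
    rw [← Complex.normSq_apply, ← Complex.sq_norm]
    nlinarith [norm_nonneg w]
  have h3 : (wmapInv p w).im =
      p.im * (1 - (w.re * w.re + w.im * w.im)) / Complex.normSq (1 - w) := by
    rw [wmapInv, Complex.div_im]
    simp
    ring
  rw [h3]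
  exact div_pos (mul_pos hp (by linarith)) h1

lemma wmapInv_wmap (hp : 0 < p.im) (hz : 0 < z.im) : wmapInv p (wmap p z) = z := by
  have h := sub_conj_ne_zero hp hz
  rw [wmapInv, div_eq_iff (one_sub_wmap_ne_zero hp hz), wmap]
  field_simp
  ring

end DiscCoordinate

/-- The closed form `(1 - w)/Im p - 1/Im z` of `sfun p 1`. -/
noncomputable def sfunBase (p z : ℂ) : ℂ := (p.im : ℂ)⁻¹ * (1 - wmap p z) - (z.im : ℂ)⁻¹

lemma sfun_eq_pow (p : ℂ) (n : ℕ) (z : ℂ) : sfun p n z = sfunBase p z ^ n := by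
  rw [sfunBase, sub_eq_add_neg, add_pow, sfun]
  refine Finset.sum_congr rfl fun t _ => ?_
  rw [neg_pow (z.im : ℂ)⁻¹, mul_pow, inv_pow, inv_pow, div_eq_mul_inv, mul_inv]
  ring

lemma hasWirtingerDerivAt_one_sub_wmap {p z : ℂ} (hp : 0 < p.im) (hz : 0 < z.im) :
    HasWirtingerDerivAt (fun x => 1 - wmap p x)
      (Complex.I / 2 * (p.im : ℂ)⁻¹ * (1 - wmap p z) ^ 2) z := by
  have hp' : (p.im : ℂ) ≠ 0 := by exact_mod_cast hp.ne'
  have h := ((hasDerivAt_wmap hp hz).const_sub 1).hasWirtingerDerivAt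
  convert h using 1
  field_simp
  linear_combination ((1 - wmap p z) ^ 2) * Complex.I_sq

lemma hasWirtingerDerivAt_sfunBase {p z : ℂ} (hp : 0 < p.im) (hz : 0 < z.im) :
    HasWirtingerDerivAt (sfunBase p)
      (Complex.I / 2 * sfunBase p z *
        ((p.im : ℂ)⁻¹ * (1 - wmap p z) + (z.im : ℂ)⁻¹)) z := by
  refine (((hasWirtingerDerivAt_one_sub_wmap hp hz).const_mul (p.im : ℂ)⁻¹).sub
    (hasWirtingerDerivAt_inv_im hz)).congr_deriv ?_
  simp only [sfunBase]
  ring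

/-- The numerical coefficient `C(m,r) (k+r)_{m-r}`. -/
noncomputable def expansionCoeff (k m r : ℕ) : ℂ :=
  (m.choose r : ℂ) * (ascPochhammer ℂ (m - r)).eval ((k : ℂ) + r)

lemma expansionCoeff_zero_right (k m : ℕ) :
    expansionCoeff k (m + 1) 0 = (k + m) * expansionCoeff k m 0 := by
  simp [expansionCoeff, ascPochhammer_succ_eval]
  ring

lemma expansionCoeff_self_succ (k m : ℕ) : expansionCoeff k m (m + 1) = 0 := by
  simp [expansionCoeff]

lemma expansionCoeff_succ_succ {k m r : ℕ} (hr : r ≤ m) :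
    expansionCoeff k (m + 1) (r + 1) =
      (k + m + (r + 1)) * expansionCoeff k m (r + 1) + expansionCoeff k m r := by
  obtain rfl | hr := hr.eq_or_lt
  · simp [expansionCoeff]
  obtain ⟨d, rfl⟩ := Nat.exists_eq_add_of_lt hr
  have h1 : r + d + 1 + 1 - (r + 1) = d + 1 := by omega
  have h2 : r + d + 1 - (r + 1) = d := by omega
  have h3 : r + d + 1 - r = d + 1 := by omega
  have h4 : (((r + d + 1).choose (r + 1) : ℕ) : ℂ) * (r + 1) =
      ((r + d + 1).choose r : ℂ) * (d + 1) := by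
    have := Nat.choose_succ_right_eq (r + d + 1) r
    rw [h3] at this
    exact_mod_cast this
  have h5 : (ascPochhammer ℂ (d + 1)).eval ((k : ℂ) + r) =
      (k + r) * (ascPochhammer ℂ d).eval ((k : ℂ) + (r + 1)) := by
    rw [ascPochhammer_succ_left]
    simp [Polynomial.eval_comp, add_assoc]
  simp only [expansionCoeff, h1, h2, h3, h5, Nat.choose_succ_succ (r + d + 1) r]
  push_cast
  rw [ascPochhammer_succ_eval]
  linear_combination (-(ascPochhammer ℂ d).eval ((k : ℂ) + (r + 1))) * h4

lemma sum_expansionCoeff_succ (k m : ℕ) (X : ℕ → ℂ) :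
    ∑ r ∈ Finset.range (m + 1), expansionCoeff k m r * ((k + m + r) * X r + X (r + 1)) =
      ∑ r ∈ Finset.range (m + 2), expansionCoeff k (m + 1) r * X r := by
  have h := Finset.sum_range_succ (fun r : ℕ => (k + m + r) * expansionCoeff k m r * X r) (m + 1)
  rw [Finset.sum_range_succ', expansionCoeff_self_succ] at h
  push_cast at h
  have hl : ∑ r ∈ Finset.range (m + 1),
      expansionCoeff k m r * ((k + m + r) * X r + X (r + 1)) =
      ∑ r ∈ Finset.range (m + 1), (k + m + r) * expansionCoeff k m r * X r +
        ∑ r ∈ Finset.range (m + 1), expansionCoeff k m r * X (r + 1) := by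
    rw [← Finset.sum_add_distrib]
    exact Finset.sum_congr rfl fun r _ => by ring
  have hr : ∑ r ∈ Finset.range (m + 1), expansionCoeff k (m + 1) (r + 1) * X (r + 1) =
      ∑ r ∈ Finset.range (m + 1), (k + m + (r + 1)) * expansionCoeff k m (r + 1) * X (r + 1) +
        ∑ r ∈ Finset.range (m + 1), expansionCoeff k m r * X (r + 1) := by
    rw [← Finset.sum_add_distrib]
    refine Finset.sum_congr rfl fun r hr => ?_
    rw [expansionCoeff_succ_succ (Nat.lt_succ_iff.mp (Finset.mem_range.mp hr)), add_mul]
  rw [Finset.sum_range_succ' _ (m + 1), expansionCoeff_zero_right, hl, hr]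
  linear_combination -h

/-- The building block `(s/(4π))^j (1 - w)^e G(w)`. -/
noncomputable def expansionTerm (p : ℂ) (j e : ℕ) (G : ℂ → ℂ) (z : ℂ) : ℂ :=
  ((4 * (Real.pi : ℂ))⁻¹ * sfunBase p z) ^ j * (1 - wmap p z) ^ e * G (wmap p z)

lemma hasWirtingerDerivAt_expansionTerm {p z : ℂ} (hp : 0 < p.im) (hz : 0 < z.im) (j e : ℕ)
    {G : ℂ → ℂ} {G' : ℂ} (hG : HasDerivAt G (-4 * Real.pi * p.im * G') (wmap p z)) :
    HasWirtingerDerivAt (expansionTerm p j e G)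
      (Complex.I / 2 * ((j * ((p.im : ℂ)⁻¹ * (1 - wmap p z) + (z.im : ℂ)⁻¹) +
          e * ((p.im : ℂ)⁻¹ * (1 - wmap p z))) * expansionTerm p j e G z +
        4 * Real.pi * expansionTerm p j (e + 2) (fun _ => G') z)) z := by
  have hp' : (p.im : ℂ) ≠ 0 := by exact_mod_cast hp.ne'
  have hw := (hasDerivAt_wmap hp hz).hasWirtingerDerivAt
  have hs := ((hasWirtingerDerivAt_sfunBase hp hz).const_mul (4 * (Real.pi : ℂ))⁻¹).pow j
  have hu := (hasWirtingerDerivAt_one_sub_wmap hp hz).pow e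
  refine ((hs.mul hu).mul (HasWirtingerDerivAt.comp hG hw)).congr_deriv ?_
  have hj (x : ℂ) : (j : ℂ) * x ^ (j - 1) * x = j * x ^ j := by
    cases j <;> simp [pow_succ]; ring
  have he (x : ℂ) : (e : ℂ) * x ^ (e - 1) * x = e * x ^ e := by
    cases e <;> simp [pow_succ]; ring
  have hI : (1 - wmap p z) ^ 2 / (2 * Complex.I * p.im) =
      -(Complex.I / 2 * (p.im : ℂ)⁻¹ * (1 - wmap p z) ^ 2) := by
    field_simp
    linear_combination ((1 - wmap p z) ^ 2) * Complex.I_sq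
  have hpi := mul_inv_cancel₀ hp'
  rw [hI]
  unfold expansionTerm
  linear_combination
    (Complex.I / 2 * ((p.im : ℂ)⁻¹ * (1 - wmap p z) + (z.im : ℂ)⁻¹) *
      (1 - wmap p z) ^ e * G (wmap p z)) * hj ((4 * (Real.pi : ℂ))⁻¹ * sfunBase p z) +
    (((4 * (Real.pi : ℂ))⁻¹ * sfunBase p z) ^ j * (Complex.I / 2 * (p.im : ℂ)⁻¹ *
      (1 - wmap p z)) * G (wmap p z)) * he (1 - wmap p z) +
    (((4 * (Real.pi : ℂ))⁻¹ * sfunBase p z) ^ j * (1 - wmap p z) ^ (e + 2) * Complex.I / 2 *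
      4 * Real.pi * G') * hpi

/-- If `f = (1 - w)^k G₀(w)` where `G_r' = -4π (Im p) G_{r+1}` on the unit disc, then the
iterated Shimura–Maass derivatives of `f` are explicit combinations of the `G_r(w)`. -/
lemma smIter_eq_sum_expansionTerm {k : ℕ} {f : ℂ → ℂ} {p : ℂ} (hp : 0 < p.im) {G : ℕ → ℂ → ℂ}
    (hG : ∀ r w, ‖w‖ < 1 → HasDerivAt (G r) (-4 * Real.pi * p.im * G (r + 1) w) w)
    (hf : ∀ z : ℂ, 0 < z.im → f z = (1 - wmap p z) ^ k * G 0 (wmap p z))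
    (m : ℕ) {z : ℂ} (hz : 0 < z.im) :
    smIter k f m z = ∑ r ∈ Finset.range (m + 1),
      expansionCoeff k m r * expansionTerm p (m - r) (k + 2 * r) (G r) z := by
  induction m generalizing z with
  | zero => simp [smIter, expansionCoeff, expansionTerm, hf z hz]
  | succ m ih =>
    have hev : smIter k f m =ᶠ[nhds z] fun x => ∑ r ∈ Finset.range (m + 1),
        expansionCoeff k m r * expansionTerm p (m - r) (k + 2 * r) (G r) x := by
      filter_upwards [(isOpen_lt continuous_const Complex.continuous_im).mem_nhds hz] with x hx
      exact ih hx
    have hz' : (z.im : ℂ) ≠ 0 := by exact_mod_cast hz.ne'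
    have hπ : (Real.pi : ℂ) ≠ 0 := by exact_mod_cast Real.pi_ne_zero
    have hd := ((HasWirtingerDerivAt.sum (Finset.range (m + 1)) fun r _ =>
      (hasWirtingerDerivAt_expansionTerm hp hz (m - r) (k + 2 * r)
        (hG r _ (norm_wmap_lt_one hp hz))).const_mul
          (expansionCoeff k m r)).congr_of_eventuallyEq hev).wirtingerDeriv_eq
    simp only [smIter]
    rw [hd, ih hz, ← sum_expansionCoeff_succ k m
      (fun r => expansionTerm p (m + 1 - r) (k + 2 * r) (G r) z), Finset.mul_sum,
      Finset.sum_div, ← Finset.sum_add_distrib, Finset.mul_sum]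
    refine Finset.sum_congr rfl fun r hr => ?_
    obtain ⟨d, rfl⟩ := Nat.exists_eq_add_of_le (Nat.lt_succ_iff.mp (Finset.mem_range.mp hr))
    have h1 : r + d + 1 - r = d + 1 := by omega
    have h2 : r + d + 1 - (r + 1) = d := by omega
    have h3 : z - (starRingEnd ℂ) z = 2 * Complex.I * z.im := by
      rw [Complex.sub_conj]; push_cast; ring
    have h4 : k + 2 * (r + 1) = k + 2 * r + 2 := by ring
    have h5 : expansionTerm p (d + 1) (k + 2 * r) (G r) z = (4 * (Real.pi : ℂ))⁻¹ *
        ((p.im : ℂ)⁻¹ * (1 - wmap p z) - (z.im : ℂ)⁻¹) *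
          expansionTerm p d (k + 2 * r) (G r) z := by
      simp only [expansionTerm, sfunBase]
      ring
    have h6 : expansionTerm p d (k + 2 * r + 2) (fun _ => G (r + 1) (wmap p z)) z =
        expansionTerm p d (k + 2 * r + 2) (G (r + 1)) z := rfl
    simp only [Nat.add_sub_cancel_left, h1, h2, h3, h4, h5, h6]
    push_cast
    field_simp
    ring_nf
    simp only [Complex.I_sq]
    ring

lemma hasDerivAt_iteratedDeriv_of_differentiableOn_ball {g : ℂ → ℂ} {c : ℂ} {R : ℝ}
    (hg : DifferentiableOn ℂ g (Metric.ball c R)) (r : ℕ) {w : ℂ} (hw : w ∈ Metric.ball c R) :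
    HasDerivAt (iteratedDeriv r g) (iteratedDeriv (r + 1) g w) w := by
  have h := (hg.analyticOnNhd Metric.isOpen_ball).iterated_deriv r w hw
  rw [iteratedDeriv_succ, iteratedDeriv_eq_iterate]
  exact h.differentiableAt.hasDerivAt

theorem smIter_power_series_expansion (k : ℕ) (hk : Even k) (f : ℂ → ℂ)
    (hf : ∀ z : ℂ, 0 < z.im → DifferentiableAt ℂ f z)
    (p : ℂ) (hp : 0 < p.im) (m : ℕ) (z : ℂ) (hz : 0 < z.im) :
    (∀ r : ℕ, r ≤ m →
      Summable (fun n : ℕ =>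
        smIter (k : ℤ) f (n + r) p / (n.factorial : ℂ) *
          (-4 * (Real.pi : ℂ) * (p.im : ℂ)) ^ n * wmap p z ^ n)) ∧
    smIter (k : ℤ) f m z =
      ∑ r ∈ Finset.range (m + 1),
        (m.choose r : ℂ) *
          ((ascPochhammer ℂ (m - r)).eval ((k : ℂ) + r) * sfun p (m - r) z /
            (4 * (Real.pi : ℂ)) ^ (m - r)) *
          (1 - wmap p z) ^ (k + 2 * r) *
          ∑' n : ℕ,
            smIter (k : ℤ) f (n + r) p / (n.factorial : ℂ) *
              (-4 * (Real.pi : ℂ) * (p.im : ℂ)) ^ n * wmap p z ^ n := by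
  have hy : (p.im : ℂ) ≠ 0 := by exact_mod_cast hp.ne'
  have hπ : (Real.pi : ℂ) ≠ 0 := by exact_mod_cast Real.pi_ne_zero
  set c : ℂ := -4 * (Real.pi : ℂ) * (p.im : ℂ) with hc
  have hc0 : c ≠ 0 := by simp [hc, hy, hπ]
  set g : ℂ → ℂ := fun w => f (wmapInv p w) / (1 - w) ^ k with hgdef
  have hg : DifferentiableOn ℂ g (Metric.ball 0 1) := by
    intro w hw
    have hw' : ‖w‖ < 1 := by simpa using hw
    have h1 := one_sub_ne_zero_of_norm_lt_one hw'
    have h2 : DifferentiableAt ℂ (wmapInv p) w := by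
      unfold wmapInv
      fun_prop (disch := exact h1)
    have h3 : DifferentiableAt ℂ (fun w => f (wmapInv p w)) w :=
      DifferentiableAt.comp w (hf _ (wmapInv_im_pos hp hw')) h2
    have h4 : DifferentiableAt ℂ (fun w : ℂ => (1 - w) ^ k) w := by fun_prop
    exact (h3.fun_div h4 (pow_ne_zero k h1)).differentiableWithinAt
  set G : ℕ → ℂ → ℂ := fun r w => (c ^ r)⁻¹ * iteratedDeriv r g w with hGdef
  have hG : ∀ r w, ‖w‖ < 1 → HasDerivAt (G r) (c * G (r + 1) w) w := by
    intro r w hw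
    refine ((hasDerivAt_iteratedDeriv_of_differentiableOn_ball hg r
      (by simpa using hw)).const_mul (c ^ r)⁻¹).congr_deriv ?_
    simp only [hGdef]
    field_simp
    ring
  have hfG : ∀ z : ℂ, 0 < z.im → f z = (1 - wmap p z) ^ k * G 0 (wmap p z) := by
    intro z hz
    have := pow_ne_zero k (one_sub_wmap_ne_zero hp hz)
    simp only [hGdef, hgdef, iteratedDeriv_zero, wmapInv_wmap hp hz]
    field_simp
  have hexp := fun m {z} hz => smIter_eq_sum_expansionTerm (z := z) hp hG hfG m hz
  have hval : ∀ n, smIter (k : ℤ) f n p = G n 0 := by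
    intro n
    have hw0 : wmap p p = 0 := by simp [wmap]
    have hs0 : sfunBase p p = 0 := by simp [sfunBase, hw0]
    rw [hexp n hp, Finset.sum_eq_single_of_mem n (by simp)]
    · simp [expansionCoeff, expansionTerm, hw0]
    · intro r hr hrn
      have : n - r ≠ 0 := by have := Finset.mem_range.mp hr; omega
      simp [expansionTerm, hs0, this]
  have hsum : ∀ r, HasSum (fun n : ℕ => smIter (k : ℤ) f (n + r) p / (n.factorial : ℂ) *
      c ^ n * wmap p z ^ n) (G r (wmap p z)) := by
    intro r
    have hd : DifferentiableOn ℂ (iteratedDeriv r g) (Metric.ball 0 1) := fun w hw =>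
      (hasDerivAt_iteratedDeriv_of_differentiableOn_ball hg r hw).differentiableAt
        |>.differentiableWithinAt
    have hw : wmap p z ∈ Metric.ball (0 : ℂ) 1 := by simpa using norm_wmap_lt_one hp hz
    refine ((Complex.hasSum_taylorSeries_on_ball hd hw).mul_left (c ^ r)⁻¹).congr_fun fun n => ?_
    have hit : iteratedDeriv n (iteratedDeriv r g) = iteratedDeriv (n + r) g := by
      simp only [iteratedDeriv_eq_iterate, Function.iterate_add_apply]
    rw [hval, hit]
    simp only [hGdef, smul_eq_mul, sub_zero, pow_add]
    field_simp
  refine ⟨fun r _ => (hsum r).summable, ?_⟩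
  rw [hexp m hz]
  refine Finset.sum_congr rfl fun r _ => ?_
  rw [(hsum r).tsum_eq, sfun_eq_pow, expansionCoeff, expansionTerm, mul_pow, inv_pow]
  ring
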